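/- Let n be a finite index type, let K : ℝ → Matrix n n ℝ be a matrix-valued function whose entries are differentiable at t₀, with entrywise derivative K'(t₀). Assume K(t) is invertible for all t in a neighborhood of t₀ and that K(t₀) is symmetric. Let F : n → ℝ be a fixed load vector and define the displacement U(t) = (K(t))⁻¹ · F (so that K(t) U(t) = F). Then the compliance t ↦ (1/2) F ⬝ᵥ U(t) is differentiable at t₀ with derivative equal to −(1/2) U(t₀) ⬝ᵥ (K'(t₀) · U(t₀)). -/

import Mathlib

open Matrix

/-- Adjoint (self-adjoint) sensitivity identity for compliance: for the state
equation `K U = F` with symmetric stiffness matrix `K` depending on a design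
parameter `t`, the derivative of the compliance `(1/2) Fᵀ U` at `t₀` equals
`-(1/2) U(t₀)ᵀ (dK/dt)(t₀) U(t₀)`. -/
theorem compliance_sensitivity {n : Type*} [Fintype n] [DecidableEq n]
    (K : ℝ → Matrix n n ℝ) (K' : Matrix n n ℝ) (t₀ : ℝ)
    (hderiv : ∀ i j, HasDerivAt (fun t => K t i j) (K' i j) t₀)
    (hinv : ∀ᶠ t in nhds t₀, IsUnit (K t))
    (hsymm : (K t₀).IsSymm)
    (F : n → ℝ) (U : ℝ → n → ℝ) (hU : ∀ t, U t = (K t)⁻¹.mulVec F) :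
    HasDerivAt (fun t => (1 / 2 : ℝ) * (F ⬝ᵥ U t))
      (-(1 / 2 : ℝ) * (U t₀ ⬝ᵥ K'.mulVec (U t₀))) t₀ := by
  have hKc : ContinuousAt K t₀ :=
    continuousAt_pi.2 fun i => continuousAt_pi.2 fun j => (hderiv i j).continuousAt
  have hdet : (K t₀).det ≠ 0 := ((Matrix.isUnit_iff_isUnit_det _).1 hinv.self_of_nhds).ne_zero
  have hUc : ContinuousAt U t₀ := by
    have h1 : ContinuousAt (fun t => (K t).det) t₀ :=
      (Continuous.matrix_det continuous_id).continuousAt.comp hKc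
    have h2 : ContinuousAt (fun t => (K t).adjugate) t₀ :=
      (Continuous.matrix_adjugate continuous_id).continuousAt.comp hKc
    have h3 : ContinuousAt (fun t => (K t)⁻¹) t₀ := by
      simp only [Matrix.inv_def, Ring.inverse_eq_inv']
      exact (h1.inv₀ hdet).smul h2
    have h4 : U = fun t => (K t)⁻¹.mulVec F := funext hU
    rw [h4]
    exact (Continuous.matrix_mulVec continuous_id
      (continuous_const (y := F))).continuousAt.comp h3
  have hKU : ∀ t, IsUnit (K t) → (K t).mulVec (U t) = F := by
    intro t ht
    rw [hU, Matrix.mulVec_mulVec,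
      Matrix.mul_nonsing_inv _ ((Matrix.isUnit_iff_isUnit_det _).1 ht), Matrix.one_mulVec]
  have h0 := hKU t₀ hinv.self_of_nhds
  have key : ∀ t, IsUnit (K t) →
      F ⬝ᵥ U t - F ⬝ᵥ U t₀ = -(U t₀ ⬝ᵥ (K t - K t₀).mulVec (U t)) := by
    intro t ht
    have e : F ⬝ᵥ U t = U t₀ ⬝ᵥ (K t₀).mulVec (U t) := by
      rw [Matrix.dotProduct_mulVec, ← Matrix.mulVec_transpose, hsymm.eq, h0]
    rw [Matrix.sub_mulVec, dotProduct_sub, hKU t ht, e, dotProduct_comm F]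
    ring
  have hS : Filter.Tendsto (fun t => (t - t₀)⁻¹ • (K t - K t₀)) (nhdsWithin t₀ {t₀}ᶜ)
      (nhds K') := by
    refine tendsto_pi_nhds.2 fun i => tendsto_pi_nhds.2 fun j => ?_
    have := hasDerivAt_iff_tendsto_slope.1 (hderiv i j)
    simpa [slope_fun_def] using this
  have hc : Continuous (fun p : Matrix n n ℝ × (n → ℝ) =>
      -(1 / 2 : ℝ) * (U t₀ ⬝ᵥ p.1.mulVec p.2)) :=
    continuous_const.mul
      (Continuous.dotProduct continuous_const (continuous_fst.matrix_mulVec continuous_snd))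
  rw [hasDerivAt_iff_tendsto_slope]
  have hT := (hc.tendsto (K', U t₀)).comp
    (hS.prodMk_nhds (hUc.tendsto.mono_left nhdsWithin_le_nhds))
  refine hT.congr' ?_
  filter_upwards [hinv.filter_mono nhdsWithin_le_nhds] with t ht
  simp only [Function.comp, slope_def_field, ← mul_sub, key t ht, Matrix.smul_mulVec,
    dotProduct_smul, smul_eq_mul]
  ring
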